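/- The position attachment centrality is the unique centrality measure σ (assigning to each graph Γ=(N,E) a vector in ℝ^N) satisfying: (1) Locality: σ_i(Γ) depends only on the connected component of i; (2) Normalisation: σ_i(Γ) ∈ [0, n−1], σ_i(Γ)=0 for isolated i, and σ_1(Γ*) = n−1 for the hub 1 of the n-node star Γ*; (3) Gain-Loss: adding an edge between two nodes of a connected graph does not change the sum of all centralities; (4) Balanced link contributions: for all i,j ∈ N, Σ_{l∈E_j}(σ_i(Γ) − σ_i(Γ−l)) = Σ_{l∈E_i}(σ_j(Γ) − σ_j(Γ−l)). -/

import Mathlib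

open scoped Classical

noncomputable section

variable {V : Type*} [Fintype V] [DecidableEq V]

/-- The vertex set of the connected component of `i` in the graph with edge set `L`. -/
def comp (L : Finset (Sym2 V)) (i : V) : Finset V :=
  Finset.univ.filter fun j =>
    (SimpleGraph.fromEdgeSet (↑L : Set (Sym2 V))).Reachable i j

/-- Nodes covered by the edge set `L` (the node set `N[L]`). -/
def covered (L : Finset (Sym2 V)) : Finset V :=
  Finset.univ.filter fun i => ∃ e ∈ L, i ∈ e

/-- The collection of (vertex sets of) connected components of the edge-induced
subgraph `Γ_L = (N[L], L)`. -/
def comps (L : Finset (Sym2 V)) : Finset (Finset V) :=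
  (covered L).image (comp L)

/-- The link game `w^v` associated with the game `v` and an edge set. -/
def linkGame (v : Finset V → ℝ) (L : Finset (Sym2 V)) : ℝ :=
  ∑ C ∈ comps L, v C

/-- Shapley value of player `e` in the game `w` with player set `E`. -/
def shapley {α : Type*} [DecidableEq α] (E : Finset α) (w : Finset α → ℝ) (e : α) : ℝ :=
  ∑ L ∈ (E.erase e).powerset,
    ((L.card.factorial : ℝ) * ((E.card - L.card - 1).factorial : ℝ) / (E.card.factorial : ℝ)) *
      (w (insert e L) - w L)

/-- Harsanyi dividend of coalition `L` in the game `w`. -/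
def dividend {α : Type*} [DecidableEq α] (w : Finset α → ℝ) (L : Finset α) : ℝ :=
  ∑ T ∈ L.powerset, (-1 : ℝ) ^ (L.card - T.card) * w T

/-- The position value of node `i` in the communication situation `(N, v, E)`. -/
def positionValue (v : Finset V → ℝ) (E : Finset (Sym2 V)) (i : V) : ℝ :=
  (1 / 2) * ∑ e ∈ E.filter (fun e => i ∈ e), shapley E (linkGame v) e

def Superadditive (v : Finset V → ℝ) : Prop :=
  ∀ S T : Finset V, Disjoint S T → v S + v T ≤ v (S ∪ T)

def ConvexGame (v : Finset V → ℝ) : Prop :=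
  ∀ S T : Finset V, v S + v T ≤ v (S ∪ T) + v (S ∩ T)

def ZeroNormalized (v : Finset V → ℝ) : Prop :=
  v ∅ = 0 ∧ ∀ i : V, v {i} = 0

def SymmetricGame (v : Finset V → ℝ) (f : ℕ → ℝ) : Prop :=
  ∀ S : Finset V, v S = f S.card

/-- An edge set without loops. -/
def SimpleEdges (E : Finset (Sym2 V)) : Prop := ∀ e ∈ E, ¬ e.IsDiag

/-- The edge-induced subgraph `Γ_L = (N[L], L)` is connected. -/
def EdgeConnected (L : Finset (Sym2 V)) : Prop :=
  ∀ i ∈ covered L, ∀ j ∈ covered L,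
    (SimpleGraph.fromEdgeSet (↑L : Set (Sym2 V))).Reachable i j

/-- Component of `i` in the subgraph of `Γ_L` induced on the vertex set `S`. -/
def compIn (L : Finset (Sym2 V)) (S : Finset V) (i : V) : Finset V :=
  S.filter fun j =>
    (SimpleGraph.fromEdgeSet
      (↑(L.filter fun e => ∀ x ∈ e, x ∈ S) : Set (Sym2 V))).Reachable i j

/-- Number of connected components of the subgraph of `Γ_L` induced on `S`. -/
def numCompsIn (L : Finset (Sym2 V)) (S : Finset V) : ℕ :=
  (S.image (compIn L S)).card

/-- A cutvertex of `Γ_L`: a vertex whose removal increases the number of components. -/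
def IsCutvertex (L : Finset (Sym2 V)) (i : V) : Prop :=
  i ∈ covered L ∧ numCompsIn L (covered L) < numCompsIn L ((covered L).erase i)

/-- The set of cutedges of `L`: edges both of whose endpoints are cutvertices. -/
def cutedges (L : Finset (Sym2 V)) : Finset (Sym2 V) :=
  L.filter fun e => ∀ x ∈ e, IsCutvertex L x

/-- The attachment game `v_a(S) = 2(|S| - 1)` (and `v_a(∅) = 0`). -/
def va : Finset V → ℝ := fun S => if S = ∅ then 0 else 2 * ((S.card : ℝ) - 1)

/-- The star on `V` with hub `c`: all (non-loop) edges incident to `c`. -/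
def starEdges (c : V) : Finset (Sym2 V) :=
  Finset.univ.filter fun e => ¬ e.IsDiag ∧ c ∈ e

/-- The chain (path) on `Fin n`, with edges `{i, i+1}`. -/
def chainEdges (n : ℕ) : Finset (Sym2 (Fin n)) :=
  Finset.univ.filter fun e => ∃ i j : Fin n, e = s(i, j) ∧ (j : ℕ) = (i : ℕ) + 1

/-- `F(s, r) = ∑_{k=0}^{r} (-1)^k C(r,k) f(s-k)` for `f : ℕ → ℝ`. -/
def Ffun (f : ℕ → ℝ) (s r : ℕ) : ℝ :=
  ∑ k ∈ Finset.range (r + 1), (-1 : ℝ) ^ k * (r.choose k : ℝ) * f (s - k)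

/-- `F(s, r) = ∑_{k=0}^{r} (-1)^k C(r,k) f(s-k)` for `f : ℝ → ℝ`. -/
def FfunR (f : ℝ → ℝ) (s r : ℕ) : ℝ :=
  ∑ k ∈ Finset.range (r + 1), (-1 : ℝ) ^ k * (r.choose k : ℝ) * f ((s : ℝ) - (k : ℝ))


/-- A centrality measure: for every finite simple graph (on any finite vertex set)
a real value for each node. -/
def CentralityMeasure : Type 1 :=
  ∀ (W : Type) [Fintype W] [DecidableEq W], Finset (Sym2 W) → W → ℝ

/-- The edges of `E` inside `S`, as edges of the subtype `{x // x ∈ S}`. -/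
def restrictEdges {W : Type} [Fintype W] [DecidableEq W]
    (E : Finset (Sym2 W)) (S : Finset W) : Finset (Sym2 {x : W // x ∈ S}) :=
  Finset.univ.filter fun e => e.map Subtype.val ∈ E

/-- Locality: the centrality of a node depends solely on the component to which it
belongs, i.e. it equals its centrality in the graph `(K_i(Γ), E[K_i(Γ)])`. -/
def SatLocality (σ : CentralityMeasure) : Prop :=
  ∀ (W : Type) [Fintype W] [DecidableEq W],
    ∀ (E : Finset (Sym2 W)), SimpleEdges E → ∀ (i : W) (hi : i ∈ comp E i),
      σ W E i =
        σ {x : W // x ∈ comp E i} (restrictEdges E (comp E i)) ⟨i, hi⟩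

/-- Normalisation: values lie in `[0, n-1]`, isolated nodes get `0`, and the hub of
the `n`-node star gets `n-1`. -/
def SatNormalisation (σ : CentralityMeasure) : Prop :=
  ∀ (W : Type) [Fintype W] [DecidableEq W],
    ∀ (E : Finset (Sym2 W)), SimpleEdges E →
      (∀ i : W, 0 ≤ σ W E i ∧ σ W E i ≤ (Fintype.card W : ℝ) - 1) ∧
      (∀ i : W, (∀ e ∈ E, i ∉ e) → σ W E i = 0) ∧
      (∀ c : W, E = starEdges c → σ W E c = (Fintype.card W : ℝ) - 1)

/-- Gain-Loss: adding an edge to a connected graph does not change the sum of all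
centralities. -/
def SatGainLoss (σ : CentralityMeasure) : Prop :=
  ∀ (W : Type) [Fintype W] [DecidableEq W],
    ∀ (E : Finset (Sym2 W)), SimpleEdges E →
      (∀ a b : W, (SimpleGraph.fromEdgeSet (↑E : Set (Sym2 W))).Reachable a b) →
      ∀ i j : W, i ≠ j → s(i, j) ∉ E →
        ∑ x : W, σ W (insert s(i, j) E) x = ∑ x : W, σ W E x

/-- Balanced link contributions. -/
def SatBalanced (σ : CentralityMeasure) : Prop :=
  ∀ (W : Type) [Fintype W] [DecidableEq W],
    ∀ (E : Finset (Sym2 W)), SimpleEdges E → ∀ i j : W,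
      ∑ l ∈ E.filter (fun e => j ∈ e), (σ W E i - σ W (E.erase l) i) =
        ∑ l ∈ E.filter (fun e => i ∈ e), (σ W E j - σ W (E.erase l) j)

/-- The Hart–Mas-Colell potential of the game `w` restricted to the player set `E`. -/
def potential {α : Type*} [DecidableEq α] (w : Finset α → ℝ) (E : Finset α) : ℝ :=
  ∑ L ∈ E.powerset,
    (((L.card - 1).factorial : ℝ) * ((E.card - L.card).factorial : ℝ) / (E.card.factorial : ℝ)) *
      w L

lemma potential_empty {α : Type*} [DecidableEq α] {w : Finset α → ℝ} (h0 : w ∅ = 0) :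
    potential w ∅ = 0 := by
  simp [potential, h0]

lemma shapley_eq_potential_sub {α : Type*} [DecidableEq α] {E : Finset α} {w : Finset α → ℝ}
    (h0 : w ∅ = 0) {e : α} (he : e ∈ E) :
    shapley E w e = potential w E - potential w (E.erase e) := by
  obtain ⟨F, heF, rfl⟩ : ∃ F, e ∉ F ∧ E = insert e F :=
    ⟨E.erase e, Finset.notMem_erase e E, (Finset.insert_erase he).symm⟩
  rw [shapley, potential, potential, Finset.erase_insert heF, Finset.sum_powerset_insert heF,
    ← Finset.sum_add_distrib, ← Finset.sum_sub_distrib]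
  refine Finset.sum_congr rfl fun L hL => ?_
  have hLF := Finset.mem_powerset.1 hL
  have hcard := Finset.card_le_card hLF
  rw [Finset.card_insert_of_notMem heF, Finset.card_insert_of_notMem fun h => heF (hLF h)]
  rcases L.eq_empty_or_nonempty with rfl | hne
  · simp [h0]
  obtain ⟨k, hk⟩ : ∃ k, L.card = k + 1 := Nat.exists_eq_succ_of_ne_zero hne.card_pos.ne'
  obtain ⟨d, hd⟩ := Nat.exists_eq_add_of_le hcard
  rw [hd, hk]
  have e1 : k + 1 + d + 1 - (k + 1) - 1 = d := by omega
  have e2 : k + 1 + d + 1 - (k + 1) = d + 1 := by omega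
  have e3 : k + 1 + d + 1 - (k + 1 + 1) = d := by omega
  have e4 : k + 1 + d - (k + 1) = d := by omega
  rw [e1, e2, e3, e4, Nat.add_sub_cancel, Nat.add_sub_cancel, Nat.factorial_succ (k + 1 + d),
    Nat.factorial_succ d, Nat.factorial_succ k]
  have := Nat.factorial_ne_zero (k + 1 + d)
  push_cast
  field_simp
  ring

lemma card_mul_potential {α : Type*} [DecidableEq α] {w : Finset α → ℝ} (h0 : w ∅ = 0)
    (E : Finset α) :
    (E.card : ℝ) * potential w E = w E + ∑ e ∈ E, potential w (E.erase e) := by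
  have hswap : ∑ e ∈ E, potential w (E.erase e) = ∑ L ∈ E.powerset, ∑ _e ∈ E \ L,
      (((L.card - 1).factorial : ℝ) * ((E.card - 1 - L.card).factorial : ℝ) /
        ((E.card - 1).factorial : ℝ)) * w L := by
    rw [Finset.sum_comm' (t' := E) (s' := fun e => (E.erase e).powerset)]
    · refine Finset.sum_congr rfl fun e he => ?_
      rw [potential, Finset.card_erase_of_mem he]
    · intro L e
      simp only [Finset.mem_powerset, Finset.mem_sdiff, Finset.subset_erase]
      tauto
  have hw : w E = ∑ L ∈ E.powerset, if L = E then w L else 0 := by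
    rw [Finset.sum_ite_eq' E.powerset E]
    simp
  rw [hswap, hw, potential, Finset.mul_sum, ← Finset.sum_add_distrib]
  refine Finset.sum_congr rfl fun L hL => ?_
  have hLE := Finset.mem_powerset.1 hL
  have hcard := Finset.card_le_card hLE
  rw [Finset.sum_const, Finset.card_sdiff_of_subset hLE, nsmul_eq_mul]
  rcases L.eq_empty_or_nonempty with rfl | hne
  · simp [h0]
  obtain ⟨k, hk⟩ : ∃ k, L.card = k + 1 := Nat.exists_eq_succ_of_ne_zero hne.card_pos.ne'
  split_ifs with h
  · rw [← h, hk, Nat.add_sub_cancel, Nat.factorial_succ k]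
    have := Nat.factorial_ne_zero k
    push_cast
    simp
    field_simp
  · have hlt := Finset.card_lt_card (hLE.ssubset_of_ne h)
    obtain ⟨d, hd⟩ := Nat.exists_eq_add_of_lt hlt
    rw [hd, hk]
    have e1 : k + 1 + d + 1 - (k + 1) = d + 1 := by omega
    have e2 : k + 1 + d + 1 - 1 - (k + 1) = d := by omega
    rw [e1, e2, Nat.add_sub_cancel, Nat.add_sub_cancel, Nat.factorial_succ (k + 1 + d),
      Nat.factorial_succ d]
    have := Nat.factorial_ne_zero (k + 1 + d)
    push_cast
    field_simp
    ring

lemma sum_shapley {α : Type*} [DecidableEq α] {w : Finset α → ℝ} (h0 : w ∅ = 0) (E : Finset α) :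
    ∑ e ∈ E, shapley E w e = w E := by
  rw [Finset.sum_congr rfl fun e he => shapley_eq_potential_sub h0 he, Finset.sum_sub_distrib,
    Finset.sum_const, nsmul_eq_mul, card_mul_potential h0, add_sub_cancel_right]

lemma potential_eq_add_of_split {α : Type*} [DecidableEq α] {w : Finset α → ℝ} (h0 : w ∅ = 0)
    (q : α → Prop) [DecidablePred q] (E : Finset α)
    (h : ∀ L ⊆ E, w L = w (L.filter q) + w (L.filter fun e => ¬ q e)) :
    potential w E = potential w (E.filter q) + potential w (E.filter fun e => ¬ q e) := by
  induction E using Finset.strongInduction with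
  | H E ih =>
    rcases E.eq_empty_or_nonempty with rfl | hne
    · simp [potential_empty h0]
    have hpos : (E.card : ℝ) ≠ 0 := by exact_mod_cast hne.card_pos.ne'
    have hstep : ∀ e ∈ E, potential w (E.erase e) =
        potential w ((E.filter q).erase e) +
          potential w ((E.filter fun e => ¬ q e).erase e) := by
      intro e he
      rw [ih _ (Finset.erase_ssubset he) fun L hL => h L (hL.trans (Finset.erase_subset _ _)),
        Finset.filter_erase, Finset.filter_erase]
    have hq : ∑ e ∈ E.filter q, potential w (E.erase e) =
        ∑ e ∈ E.filter q, potential w ((E.filter q).erase e) +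
          ((E.filter q).card : ℝ) * potential w (E.filter fun e => ¬ q e) := by
      rw [← nsmul_eq_mul, ← Finset.sum_const, ← Finset.sum_add_distrib]
      refine Finset.sum_congr rfl fun e he => ?_
      rw [hstep e (Finset.mem_filter.1 he).1,
        Finset.erase_eq_of_notMem (s := E.filter fun e => ¬ q e)]
      simp [(Finset.mem_filter.1 he).2]
    have hnq : ∑ e ∈ E.filter (fun e => ¬ q e), potential w (E.erase e) =
        ((E.filter fun e => ¬ q e).card : ℝ) * potential w (E.filter q) +
        ∑ e ∈ E.filter (fun e => ¬ q e), potential w ((E.filter fun e => ¬ q e).erase e) := by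
      rw [← nsmul_eq_mul, ← Finset.sum_const, ← Finset.sum_add_distrib]
      refine Finset.sum_congr rfl fun e he => ?_
      rw [hstep e (Finset.mem_filter.1 he).1, Finset.erase_eq_of_notMem (s := E.filter q)]
      simp [(Finset.mem_filter.1 he).2]
    have hc : (E.card : ℝ) = (E.filter q).card + (E.filter fun e => ¬ q e).card := by
      exact_mod_cast (Finset.card_filter_add_card_filter_not (s := E) q).symm
    apply mul_left_cancel₀ hpos
    rw [card_mul_potential h0, h E subset_rfl, ← Finset.sum_filter_add_sum_filter_not E q, hq, hnq,
      hc]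
    have h1 := card_mul_potential h0 (E.filter q)
    have h2 := card_mul_potential h0 (E.filter fun e => ¬ q e)
    linear_combination -h1 - h2

lemma potential_map {α β : Type*} [DecidableEq α] [DecidableEq β] (f : α ↪ β)
    (w : Finset β → ℝ) (E : Finset α) :
    potential w (E.map f) = potential (fun L => w (L.map f)) E := by
  rw [potential, potential, Finset.card_map]
  refine (Finset.sum_nbij (fun L => L.map f) ?_ ?_ ?_ ?_).symm
  · intro L hL
    exact Finset.mem_powerset.2 (Finset.map_subset_map.2 (Finset.mem_powerset.1 hL))
  · exact fun L _ M _ h => Finset.map_injective f h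
  · intro L hL
    obtain ⟨M, hM, rfl⟩ := Finset.subset_map_iff.1 (Finset.mem_powerset.1 hL)
    exact ⟨M, Finset.mem_powerset.2 hM, rfl⟩
  · intro L _
    rw [Finset.card_map]

/-- The nodes `a` and `b` are connected by links in `L`. -/
abbrev Linked {V : Type*} (L : Finset (Sym2 V)) (a b : V) : Prop :=
  (SimpleGraph.fromEdgeSet (↑L : Set (Sym2 V))).Reachable a b

lemma linked_of_mem {V : Type*} {L : Finset (Sym2 V)} {a b : V} (h : s(a, b) ∈ L) :
    Linked L a b := by
  by_cases hab : a = b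
  · exact hab ▸ SimpleGraph.Reachable.refl _
  · exact SimpleGraph.Adj.reachable ((SimpleGraph.fromEdgeSet_adj _).2 ⟨by simpa using h, hab⟩)

lemma Linked.induction {V : Type*} {L : Finset (Sym2 V)} {a b : V} (h : Linked L a b)
    {motive : V → Prop} (ha : motive a)
    (step : ∀ x y, Linked L a x → s(x, y) ∈ L → motive x → motive y) : motive b := by
  rw [Linked, SimpleGraph.reachable_iff_reflTransGen] at h
  induction h with
  | refl => exact ha
  | tail hx hxy ih =>
    exact step _ _ ((SimpleGraph.reachable_iff_reflTransGen _ _).2 hx)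
      (by simpa using ((SimpleGraph.fromEdgeSet_adj _).1 hxy).1) ih

lemma Linked.mono {V : Type*} {L M : Finset (Sym2 V)} (hLM : L ⊆ M) {a b : V}
    (h : Linked L a b) : Linked M a b :=
  SimpleGraph.Reachable.mono (SimpleGraph.fromEdgeSet_mono (by exact_mod_cast hLM)) h

/-- If paths in `L` starting in `t` stay in `t` and use only links of `M`, they are paths in `M`. -/
lemma Linked.of_invariant {V : Type*} {L M : Finset (Sym2 V)} {t : V → Prop}
    (ht : ∀ x y, t x → s(x, y) ∈ L → s(x, y) ∈ M ∧ t y) {a b : V} (ha : t a)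
    (h : Linked L a b) : Linked M a b ∧ t b :=
  h.induction (motive := fun b => Linked M a b ∧ t b) ⟨SimpleGraph.Reachable.refl a, ha⟩ fun x y _ hxy hx =>
    ⟨hx.1.trans (linked_of_mem (ht x y hx.2 hxy).1), (ht x y hx.2 hxy).2⟩

lemma linked_insert {V : Type*} [DecidableEq V] {L : Finset (Sym2 V)} {a b x y : V} :
    Linked (insert s(a, b) L) x y ↔
      Linked L x y ∨ (Linked L x a ∧ Linked L b y) ∨ (Linked L x b ∧ Linked L a y) := by
  constructor
  · intro h
    refine h.induction
      (motive := fun y => Linked L x y ∨ (Linked L x a ∧ Linked L b y) ∨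
        (Linked L x b ∧ Linked L a y))
      (Or.inl (SimpleGraph.Reachable.refl x)) fun u v _ huv hu => ?_
    rcases Finset.mem_insert.1 huv with heq | hmem
    · rcases Sym2.eq_iff.1 heq with ⟨rfl, rfl⟩ | ⟨rfl, rfl⟩
      · rcases hu with h | h | h
        · exact Or.inr (Or.inl ⟨h, SimpleGraph.Reachable.refl _⟩)
        · exact Or.inr (Or.inl ⟨h.1, SimpleGraph.Reachable.refl _⟩)
        · exact Or.inl h.1
      · rcases hu with h | h | h
        · exact Or.inr (Or.inr ⟨h, SimpleGraph.Reachable.refl _⟩)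
        · exact Or.inl h.1
        · exact Or.inr (Or.inr ⟨h.1, SimpleGraph.Reachable.refl _⟩)
    · have huv := linked_of_mem hmem
      rcases hu with h | h | h
      · exact Or.inl (h.trans huv)
      · exact Or.inr (Or.inl ⟨h.1, h.2.trans huv⟩)
      · exact Or.inr (Or.inr ⟨h.1, h.2.trans huv⟩)
  · have hab : Linked (insert s(a, b) L) a b := linked_of_mem (Finset.mem_insert_self _ _)
    have hm : ∀ {u v}, Linked L u v → Linked (insert s(a, b) L) u v :=
      fun h => h.mono (Finset.subset_insert _ _)
    rintro (h | h | h)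
    · exact hm h
    · exact (hm h.1).trans (hab.trans (hm h.2))
    · exact (hm h.1).trans (hab.symm.trans (hm h.2))

lemma mem_comp {L : Finset (Sym2 V)} {i j : V} : j ∈ comp L i ↔ Linked L i j := by
  simp [comp]

lemma self_mem_comp (L : Finset (Sym2 V)) (i : V) : i ∈ comp L i :=
  mem_comp.2 (SimpleGraph.Reachable.refl i)

lemma comp_eq_comp_iff {L : Finset (Sym2 V)} {i j : V} : comp L i = comp L j ↔ Linked L i j := by
  constructor
  · intro h
    exact mem_comp.1 (h ▸ self_mem_comp L j)
  · intro h
    ext k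
    rw [mem_comp, mem_comp]
    exact ⟨fun hk => h.symm.trans hk, fun hk => h.trans hk⟩

lemma comp_eq_singleton {L : Finset (Sym2 V)} {i : V} (h : ∀ e ∈ L, i ∉ e) : comp L i = {i} := by
  ext j
  rw [mem_comp, Finset.mem_singleton]
  constructor
  · intro hij
    refine hij.induction (motive := fun j => j = i) rfl ?_
    rintro x y - hxy rfl
    exact absurd (Sym2.mem_mk_left x y) (h _ hxy)
  · rintro rfl
    exact SimpleGraph.Reachable.refl _

lemma va_of_nonempty {V : Type*} [DecidableEq V] {S : Finset V} (h : S.Nonempty) : va S = 2 * ((S.card : ℝ) - 1) :=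
  if_neg h.ne_empty

lemma linkGame_va_eq (L : Finset (Sym2 V)) :
    linkGame va L = ∑ C ∈ Finset.univ.image (comp L), va C := by
  rw [linkGame, comps]
  refine Finset.sum_subset (Finset.image_subset_image (Finset.subset_univ _)) fun C hC hC' => ?_
  obtain ⟨i, -, rfl⟩ := Finset.mem_image.1 hC
  have hi : ∀ e ∈ L, i ∉ e := by
    intro e he hie
    exact hC' (Finset.mem_image_of_mem _ (by simpa [covered] using ⟨e, he, hie⟩))
  rw [comp_eq_singleton hi, va_of_nonempty (Finset.singleton_nonempty i)]
  simp

lemma linkGame_va_empty : linkGame (va : Finset V → ℝ) ∅ = 0 := by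
  simp [linkGame, comps, covered]

lemma linkGame_va_insert_of_linked {L : Finset (Sym2 V)} {a b : V} (h : Linked L a b) :
    linkGame va (insert s(a, b) L) = linkGame va L := by
  have : comp (insert s(a, b) L) = comp L := by
    ext i j
    rw [mem_comp, mem_comp, linked_insert]
    constructor
    · rintro (hij | hij | hij)
      · exact hij
      · exact hij.1.trans (h.trans hij.2)
      · exact hij.1.trans (h.symm.trans hij.2)
    · exact Or.inl
  rw [linkGame_va_eq, linkGame_va_eq, this]

lemma linkGame_va_insert_of_not_linked {L : Finset (Sym2 V)} {a b : V} (h : ¬ Linked L a b) :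
    linkGame va (insert s(a, b) L) = linkGame va L + 2 := by
  have hcomp : ∀ i, comp (insert s(a, b) L) i =
      if i ∈ comp L a ∪ comp L b then comp L a ∪ comp L b else comp L i := by
    intro i
    ext j
    rw [mem_comp, linked_insert]
    split_ifs with hi
    · rw [Finset.mem_union, mem_comp, mem_comp] at hi ⊢
      rcases hi with hi | hi
      · constructor
        · rintro (hij | hij | hij)
          · exact Or.inl (hi.trans hij)
          · exact Or.inr hij.2
          · exact Or.inl hij.2
        · rintro (hj | hj)
          · exact Or.inl (hi.symm.trans hj)
          · exact Or.inr (Or.inl ⟨hi.symm, hj⟩)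
      · constructor
        · rintro (hij | hij | hij)
          · exact Or.inr (hi.trans hij)
          · exact Or.inr hij.2
          · exact Or.inl hij.2
        · rintro (hj | hj)
          · exact Or.inr (Or.inr ⟨hi.symm, hj⟩)
          · exact Or.inl (hi.symm.trans hj)
    · rw [Finset.mem_union, mem_comp, mem_comp] at hi
      rw [mem_comp]
      constructor
      · rintro (hij | hij | hij)
        · exact hij
        · exact absurd (Or.inl hij.1.symm) hi
        · exact absurd (Or.inr hij.1.symm) hi
      · exact Or.inl
  have hne : comp L a ≠ comp L b := fun hab => h (comp_eq_comp_iff.1 hab)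
  have hdisj : Disjoint (comp L a) (comp L b) := by
    rw [Finset.disjoint_left]
    intro j hja hjb
    exact h ((mem_comp.1 hja).trans (mem_comp.1 hjb).symm)
  set K := ((Finset.univ.image (comp L)).erase (comp L a)).erase (comp L b) with hK
  have himage : Finset.univ.image (comp (insert s(a, b) L)) =
      insert (comp L a ∪ comp L b) K := by
    ext C
    simp only [hK, Finset.mem_image, Finset.mem_univ, true_and, Finset.mem_insert,
      Finset.mem_erase]
    constructor
    · rintro ⟨i, rfl⟩
      rw [hcomp]
      split_ifs with hi
      · exact Or.inl rfl
      · rw [Finset.mem_union, not_or] at hi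
        refine Or.inr ⟨fun hib => hi.2 ?_, fun hia => hi.1 ?_, i, rfl⟩
        · exact hib ▸ self_mem_comp L i
        · exact hia ▸ self_mem_comp L i
    · rintro (rfl | ⟨hb, ha, i, rfl⟩)
      · exact ⟨a, by rw [hcomp, if_pos (Finset.mem_union_left _ (self_mem_comp L a))]⟩
      · refine ⟨i, ?_⟩
        rw [hcomp, if_neg]
        rw [Finset.mem_union, mem_comp, mem_comp]
        rintro (hi | hi)
        · exact ha (comp_eq_comp_iff.2 hi.symm)
        · exact hb (comp_eq_comp_iff.2 hi.symm)
  have hnotMem : comp L a ∪ comp L b ∉ K := by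
    simp only [hK, Finset.mem_image, Finset.mem_univ, true_and, Finset.mem_erase]
    rintro ⟨-, ha, i, hi⟩
    have hai : a ∈ comp L i := hi ▸ Finset.mem_union_left _ (self_mem_comp L a)
    exact ha (hi ▸ comp_eq_comp_iff.2 (mem_comp.1 hai))
  have hma : comp L a ∈ Finset.univ.image (comp L) :=
    Finset.mem_image_of_mem _ (Finset.mem_univ _)
  have hmb : comp L b ∈ (Finset.univ.image (comp L)).erase (comp L a) :=
    Finset.mem_erase.2 ⟨hne.symm, Finset.mem_image_of_mem _ (Finset.mem_univ _)⟩
  rw [linkGame_va_eq, linkGame_va_eq, himage, Finset.sum_insert hnotMem,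
    ← Finset.add_sum_erase _ _ hma, ← Finset.add_sum_erase _ _ hmb,
    va_of_nonempty ⟨a, self_mem_comp L a⟩, va_of_nonempty ⟨b, self_mem_comp L b⟩,
    va_of_nonempty ⟨a, Finset.mem_union_left _ (self_mem_comp L a)⟩,
    Finset.card_union_of_disjoint hdisj]
  push_cast
  ring

lemma linkGame_va_insert (L : Finset (Sym2 V)) (a b : V) :
    linkGame va (insert s(a, b) L) = linkGame va L + if Linked L a b then 0 else 2 := by
  split_ifs with h
  · rw [linkGame_va_insert_of_linked h, add_zero]
  · exact linkGame_va_insert_of_not_linked h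

lemma linkGame_va_le_insert (e : Sym2 V) (L : Finset (Sym2 V)) :
    linkGame va L ≤ linkGame va (insert e L) := by
  induction e with
  | h a b =>
    rw [linkGame_va_insert]
    split_ifs <;> linarith

lemma linkGame_va_mono {L M : Finset (Sym2 V)} (h : L ⊆ M) : linkGame va L ≤ linkGame va M := by
  rw [← Finset.sdiff_union_of_subset h]
  induction M \ L using Finset.induction_on with
  | empty => rw [Finset.empty_union]
  | insert e K _ ih =>
    rw [Finset.insert_union]
    exact ih.trans (linkGame_va_le_insert e _)

lemma linkGame_va_of_connected [Nonempty V] {L : Finset (Sym2 V)} (h : ∀ a b, Linked L a b) :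
    linkGame va L = 2 * ((Fintype.card V : ℝ) - 1) := by
  have hcomp : comp L = fun _ => Finset.univ := by
    ext i j
    simp [mem_comp, h i j]
  rw [linkGame_va_eq, hcomp, Finset.image_const Finset.univ_nonempty, Finset.sum_singleton,
    va_of_nonempty Finset.univ_nonempty, Finset.card_univ]

lemma shapley_va_nonneg (E : Finset (Sym2 V)) (e : Sym2 V) : 0 ≤ shapley E (linkGame va) e :=
  Finset.sum_nonneg fun L _ =>
    mul_nonneg (by positivity) (sub_nonneg.2 (linkGame_va_le_insert e L))

lemma linkGame_va_split {E : Finset (Sym2 V)} (S : Finset V)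
    (hS : ∀ x y, s(x, y) ∈ E → (x ∈ S ↔ y ∈ S)) {L : Finset (Sym2 V)} (hL : L ⊆ E) :
    linkGame va L = linkGame va (L.filter fun e => ∀ x ∈ e, x ∈ S) +
      linkGame va (L.filter fun e => ¬ ∀ x ∈ e, x ∈ S) := by
  induction L using Finset.induction_on with
  | empty => simp [linkGame_va_empty]
  | insert e L _ ih =>
    obtain ⟨heE, hLE⟩ := Finset.insert_subset_iff.1 hL
    specialize ih hLE
    induction e with
    | h a b =>
      have hSL : ∀ x y, s(x, y) ∈ L → (x ∈ S ↔ y ∈ S) := fun x y h => hS x y (hLE h)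
      have hab := hS a b heE
      rw [Finset.filter_insert, Finset.filter_insert]
      by_cases ha : a ∈ S
      · have hmem : ∀ x ∈ s(a, b), x ∈ S := by simp [ha, hab.1 ha]
        have hiff : Linked L a b ↔ Linked (L.filter fun e => ∀ x ∈ e, x ∈ S) a b := by
          refine ⟨fun h => (h.of_invariant (t := fun x => x ∈ S) ?_ ha).1,
            Linked.mono (Finset.filter_subset _ _)⟩
          intro x y hx hxy
          have hy := (hSL x y hxy).1 hx
          simp [hxy, hx, hy]
        rw [if_pos hmem, if_neg (not_not.2 hmem), linkGame_va_insert, linkGame_va_insert, ih]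
        simp only [hiff]
        ring
      · have hmem : ¬ ∀ x ∈ s(a, b), x ∈ S := by simp [ha]
        have hiff : Linked L a b ↔ Linked (L.filter fun e => ¬ ∀ x ∈ e, x ∈ S) a b := by
          refine ⟨fun h => (h.of_invariant (t := fun x => x ∉ S) ?_ ha).1,
            Linked.mono (Finset.filter_subset _ _)⟩
          intro x y hx hxy
          have hy : y ∉ S := fun hy => hx ((hSL x y hxy).2 hy)
          simp [hxy, hx, hy]
        rw [if_neg hmem, if_pos hmem, linkGame_va_insert, linkGame_va_insert, ih]
        simp only [hiff]
        ring

lemma linked_map {U W : Type*} (f : U ↪ W) {L : Finset (Sym2 U)} {a b : U} :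
    Linked (L.map f.sym2Map) (f a) (f b) ↔ Linked L a b := by
  constructor
  · intro h
    suffices ∃ c, f c = f b ∧ Linked L a c by
      obtain ⟨c, hc, hac⟩ := this
      exact f.injective hc ▸ hac
    refine h.induction (motive := fun y => ∃ c, f c = y ∧ Linked L a c)
      ⟨a, rfl, SimpleGraph.Reachable.refl a⟩ ?_
    rintro _ y - hxy ⟨c, rfl, hac⟩
    obtain ⟨e, he, heq⟩ := Finset.mem_map.1 hxy
    induction e with
    | h u v =>
      rw [Function.Embedding.sym2Map_apply, Sym2.map_mk, Sym2.eq_iff] at heq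
      rcases heq with ⟨hu, hv⟩ | ⟨hu, hv⟩
      · exact ⟨v, hv, hac.trans (f.injective hu ▸ linked_of_mem he)⟩
      · exact ⟨u, hu, hac.trans (f.injective hv ▸ (linked_of_mem he).symm)⟩
  · intro h
    refine h.induction (motive := fun y => Linked (L.map f.sym2Map) (f a) (f y))
      (SimpleGraph.Reachable.refl _) fun x y _ hxy hx => hx.trans (linked_of_mem ?_)
    exact Finset.mem_map.2 ⟨s(x, y), hxy, rfl⟩

lemma linkGame_va_map {U : Type*} [Fintype U] [DecidableEq U] (f : U ↪ V) (L : Finset (Sym2 U)) :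
    linkGame va (L.map f.sym2Map) = linkGame va L := by
  induction L using Finset.induction_on with
  | empty => simp [linkGame_va_empty]
  | insert e L _ ih =>
    induction e with
    | h a b =>
      rw [Finset.map_insert, Function.Embedding.sym2Map_apply, Sym2.map_mk, linkGame_va_insert,
        linkGame_va_insert, ih]
      simp only [linked_map]

lemma SimpleEdges.mono {V : Type*} {L M : Finset (Sym2 V)} (hM : SimpleEdges M) (h : L ⊆ M) :
    SimpleEdges L :=
  fun e he => hM e (h he)

lemma map_restrictEdges {W : Type} [Fintype W] [DecidableEq W] (E : Finset (Sym2 W))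
    (S : Finset W) :
    (restrictEdges E S).map (Function.Embedding.subtype fun x => x ∈ S).sym2Map =
      E.filter fun e => ∀ x ∈ e, x ∈ S := by
  ext e
  simp only [restrictEdges, Finset.mem_map, Finset.mem_filter, Finset.mem_univ, true_and]
  constructor
  · rintro ⟨d, hd, rfl⟩
    refine ⟨hd, ?_⟩
    intro x hx
    obtain ⟨y, -, rfl⟩ := Sym2.mem_map.1 hx
    exact y.2
  · rintro ⟨he, hS⟩
    induction e with
    | h a b =>
      exact ⟨s(⟨a, hS a (Sym2.mem_mk_left a b)⟩, ⟨b, hS b (Sym2.mem_mk_right a b)⟩), he, rfl⟩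

lemma simpleEdges_restrictEdges {W : Type} [Fintype W] [DecidableEq W] {E : Finset (Sym2 W)}
    (hE : SimpleEdges E) (S : Finset W) : SimpleEdges (restrictEdges E S) := by
  intro e he
  induction e with
  | h a b =>
    intro hab
    refine hE _ (Finset.mem_filter.1 he).2 ?_
    rw [Sym2.mk_isDiag_iff] at hab
    simp [hab]

lemma mem_comp_iff_of_mem {L : Finset (Sym2 V)} {i x y : V} (h : s(x, y) ∈ L) :
    x ∈ comp L i ↔ y ∈ comp L i := by
  rw [mem_comp, mem_comp]
  exact ⟨fun hx => hx.trans (linked_of_mem h), fun hy => hy.trans (linked_of_mem h).symm⟩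

lemma linked_restrictEdges_comp {W : Type} [Fintype W] [DecidableEq W] {E : Finset (Sym2 W)}
    {i : W} (a b : {x : W // x ∈ comp E i}) : Linked (restrictEdges E (comp E i)) a b := by
  rw [← linked_map (Function.Embedding.subtype fun x => x ∈ comp E i), map_restrictEdges]
  have hab : Linked E (a : W) b := (mem_comp.1 a.2).symm.trans (mem_comp.1 b.2)
  refine (hab.of_invariant (t := fun x => x ∈ comp E i) ?_ a.2).1
  intro x y hx hxy
  have hy := (mem_comp_iff_of_mem hxy).1 hx
  refine ⟨Finset.mem_filter.2 ⟨hxy, ?_⟩, hy⟩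
  simp only [Sym2.mem_iff]
  rintro z (rfl | rfl) <;> assumption

lemma positionValue_va_eq (E : Finset (Sym2 V)) (i : V) :
    positionValue va E i = (1 / 2) * ∑ e ∈ E.filter (fun e => i ∈ e),
      (potential (linkGame va) E - potential (linkGame va) (E.erase e)) := by
  rw [positionValue, Finset.sum_congr rfl fun e he =>
    shapley_eq_potential_sub linkGame_va_empty (Finset.mem_filter.1 he).1]

lemma positionValue_va_restrictEdges {W : Type} [Fintype W] [DecidableEq W]
    {E : Finset (Sym2 W)} (i : W) (hi : i ∈ comp E i) :
    positionValue va E i =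
      positionValue va (restrictEdges E (comp E i)) ⟨i, hi⟩ := by
  set S := comp E i with hS
  set f := Function.Embedding.subtype fun x => x ∈ S with hf
  set w : Finset (Sym2 W) → ℝ := linkGame va with hw
  have hmap := map_restrictEdges E S
  have hsplit : ∀ L ⊆ E, potential w L = potential w (L.filter fun e => ∀ x ∈ e, x ∈ S) +
      potential w (L.filter fun e => ¬ ∀ x ∈ e, x ∈ S) := fun L hL =>
    potential_eq_add_of_split linkGame_va_empty _ L fun M hM =>
      linkGame_va_split S (fun x y h => mem_comp_iff_of_mem h) (hM.trans hL)
  have hpot : ∀ L : Finset (Sym2 {x : W // x ∈ S}),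
      potential w (L.map f.sym2Map) = potential (linkGame va) L := by
    intro L
    rw [potential_map]
    exact congrArg (fun v => potential v L) (funext fun M => linkGame_va_map f M)
  rw [positionValue_va_eq, positionValue_va_eq]
  congr 1
  symm
  refine Finset.sum_bij (fun e _ => f.sym2Map e) ?_ ?_ ?_ ?_
  · intro e he
    obtain ⟨he, hie⟩ := Finset.mem_filter.1 he
    exact Finset.mem_filter.2 ⟨(Finset.mem_filter.1 he).2, Sym2.mem_map.2 ⟨⟨i, hi⟩, hie, rfl⟩⟩
  · exact fun e _ d _ h => f.sym2Map.injective h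
  · intro e he
    obtain ⟨he, hie⟩ := Finset.mem_filter.1 he
    have heS : e ∈ E.filter fun e => ∀ x ∈ e, x ∈ S := by
      refine Finset.mem_filter.2 ⟨he, ?_⟩
      intro x hx
      rcases eq_or_ne i x with rfl | hix
      · exact hi
      · rw [(Sym2.mem_and_mem_iff hix).1 ⟨hie, hx⟩] at he
        exact (mem_comp_iff_of_mem he).1 hi
    rw [← hmap] at heS
    obtain ⟨d, hd, rfl⟩ := Finset.mem_map.1 heS
    refine ⟨d, Finset.mem_filter.2 ⟨hd, ?_⟩, rfl⟩
    obtain ⟨y, hy, hyi⟩ := Sym2.mem_map.1 hie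
    rwa [← f.injective (a₁ := y) (a₂ := ⟨i, hi⟩) hyi]
  · intro e he
    have heR := (Finset.mem_filter.1 he).1
    have hfe : f.sym2Map e ∈ E.filter fun e => ∀ x ∈ e, x ∈ S :=
      hmap ▸ Finset.mem_map_of_mem _ heR
    rw [hsplit E subset_rfl, hsplit _ (Finset.erase_subset _ _), Finset.filter_erase,
      Finset.filter_erase,
      Finset.erase_eq_of_notMem (s := E.filter fun e => ¬ ∀ x ∈ e, x ∈ S), ← hmap,
      ← Finset.map_erase, hpot, hpot]
    · ring
    · simp only [Finset.mem_filter, not_and, not_not]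
      exact fun _ => (Finset.mem_filter.1 hfe).2

lemma positionValue_va_sub_erase (E : Finset (Sym2 V)) (i : V) (l : Sym2 V) :
    positionValue va E i - positionValue va (E.erase l) i =
      (1 / 2) * ∑ e ∈ E.filter (fun e => i ∈ e),
        (potential (linkGame va) E - potential (linkGame va) (E.erase e) -
          (potential (linkGame va) (E.erase l) -
            potential (linkGame va) ((E.erase l).erase e))) := by
  have h : ∑ e ∈ (E.erase l).filter (fun e => i ∈ e), (potential (linkGame va) (E.erase l) -
      potential (linkGame va) ((E.erase l).erase e)) =
      ∑ e ∈ E.filter (fun e => i ∈ e), (potential (linkGame va) (E.erase l) -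
      potential (linkGame va) ((E.erase l).erase e)) := by
    refine Finset.sum_subset (Finset.filter_subset_filter _ (Finset.erase_subset _ _)) ?_
    intro e he he'
    have hel : e ∉ E.erase l := fun hel =>
      he' (Finset.mem_filter.2 ⟨hel, (Finset.mem_filter.1 he).2⟩)
    rw [Finset.erase_eq_of_notMem hel, sub_self]
  rw [positionValue_va_eq, positionValue_va_eq, h, ← mul_sub, ← Finset.sum_sub_distrib]

lemma positionValue_va_balanced (E : Finset (Sym2 V)) (i j : V) :
    ∑ l ∈ E.filter (fun e => j ∈ e),
        (positionValue va E i - positionValue va (E.erase l) i) =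
      ∑ l ∈ E.filter (fun e => i ∈ e),
        (positionValue va E j - positionValue va (E.erase l) j) := by
  simp only [positionValue_va_sub_erase, ← Finset.mul_sum]
  rw [Finset.sum_comm]
  congr 1
  refine Finset.sum_congr rfl fun e _ => Finset.sum_congr rfl fun l _ => ?_
  rw [Finset.erase_right_comm]
  ring

lemma sum_positionValue_va {E : Finset (Sym2 V)} (hE : SimpleEdges E) :
    ∑ i, positionValue va E i = linkGame va E := by
  simp only [positionValue]
  rw [← Finset.mul_sum, ← sum_shapley linkGame_va_empty E]
  simp only [Finset.sum_filter]
  rw [Finset.sum_comm, Finset.mul_sum]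
  refine Finset.sum_congr rfl fun e he => ?_
  have hcard : (Finset.univ.filter fun i => i ∈ e).card = 2 := by
    rw [← Sym2.card_toFinset_of_not_isDiag e (hE e he)]
    congr 1
    ext i
    simp
  rw [← Finset.sum_filter, Finset.sum_const, hcard]
  simp

lemma positionValue_va_nonneg (E : Finset (Sym2 V)) (i : V) : 0 ≤ positionValue va E i :=
  mul_nonneg (by norm_num) (Finset.sum_nonneg fun e _ => shapley_va_nonneg E e)

lemma linkGame_va_le [Nonempty V] (E : Finset (Sym2 V)) :
    linkGame va E ≤ 2 * ((Fintype.card V : ℝ) - 1) := by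
  rw [← linkGame_va_of_connected (L := Finset.univ) fun a b => linked_of_mem (Finset.mem_univ _)]
  exact linkGame_va_mono (Finset.subset_univ E)

lemma positionValue_va_le (E : Finset (Sym2 V)) (i : V) :
    positionValue va E i ≤ (Fintype.card V : ℝ) - 1 := by
  have : Nonempty V := ⟨i⟩
  have h1 : ∑ e ∈ E.filter (fun e => i ∈ e), shapley E (linkGame va) e ≤
      ∑ e ∈ E, shapley E (linkGame va) e :=
    Finset.sum_le_sum_of_subset_of_nonneg (Finset.filter_subset _ _)
      fun e _ _ => shapley_va_nonneg E e
  rw [sum_shapley linkGame_va_empty] at h1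
  have h2 := linkGame_va_le E
  rw [positionValue]
  linarith

lemma positionValue_va_of_isolated {E : Finset (Sym2 V)} {i : V} (h : ∀ e ∈ E, i ∉ e) :
    positionValue va E i = 0 := by
  rw [positionValue, Finset.filter_false_of_mem h, Finset.sum_empty, mul_zero]

lemma linked_starEdges (c a b : V) : Linked (starEdges c) a b := by
  have h : ∀ x, Linked (starEdges c) c x := by
    intro x
    by_cases hx : c = x
    · exact hx ▸ SimpleGraph.Reachable.refl c
    · exact linked_of_mem (by simp [starEdges, hx])
  exact (h a).symm.trans (h b)

lemma positionValue_va_starEdges (c : V) :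
    positionValue va (starEdges c) c = (Fintype.card V : ℝ) - 1 := by
  have : Nonempty V := ⟨c⟩
  have hfilter : (starEdges c).filter (fun e => c ∈ e) = starEdges c :=
    Finset.filter_true_of_mem fun e he => (Finset.mem_filter.1 he).2.2
  rw [positionValue, hfilter, sum_shapley linkGame_va_empty,
    linkGame_va_of_connected (linked_starEdges c)]
  ring

/-- Two measures with balanced link contributions which agree on all graphs obtained from `E` by
deleting a link differ on `E` proportionally to the degrees. -/
lemma degree_mul_sub_of_balanced {σ τ : CentralityMeasure} (hσ : SatBalanced σ)
    (hτ : SatBalanced τ) {W : Type} [Fintype W] [DecidableEq W] {E : Finset (Sym2 W)}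
    (hE : SimpleEdges E) (h : ∀ l ∈ E, ∀ i, σ W (E.erase l) i = τ W (E.erase l) i) (i j : W) :
    ((E.filter fun e => j ∈ e).card : ℝ) * (σ W E i - τ W E i) =
      ((E.filter fun e => i ∈ e).card : ℝ) * (σ W E j - τ W E j) := by
  have key : ∀ i j : W, ∑ l ∈ E.filter (fun e => j ∈ e), (σ W E i - σ W (E.erase l) i) -
      ∑ l ∈ E.filter (fun e => j ∈ e), (τ W E i - τ W (E.erase l) i) =
      ((E.filter fun e => j ∈ e).card : ℝ) * (σ W E i - τ W E i) := by
    intro i j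
    rw [← Finset.sum_sub_distrib, ← nsmul_eq_mul, ← Finset.sum_const]
    refine Finset.sum_congr rfl fun l hl => ?_
    rw [h l (Finset.mem_filter.1 hl).1]
    ring
  rw [← key, ← key, hσ W E hE i j, hτ W E hE i j]

lemma simpleEdges_starEdges (c : V) : SimpleEdges (starEdges c) :=
  fun _ he => (Finset.mem_filter.1 he).2.1

lemma restrictEdges_eq_starEdges {W : Type} [Fintype W] [DecidableEq W] {F : Finset (Sym2 W)}
    {c : W} (hF : F ⊆ starEdges c) :
    restrictEdges F (comp F c) = starEdges ⟨c, self_mem_comp F c⟩ := by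
  have hnbr : ∀ y, Linked F c y → y = c ∨ s(c, y) ∈ F := by
    intro y hy
    refine hy.induction (motive := fun y => y = c ∨ s(c, y) ∈ F) (Or.inl rfl) ?_
    intro x y _ hxy _
    rcases Sym2.mem_iff.1 (Finset.mem_filter.1 (hF hxy)).2.2 with rfl | rfl
    · exact Or.inr hxy
    · exact Or.inl rfl
  have hsimple := simpleEdges_restrictEdges ((simpleEdges_starEdges c).mono hF) (comp F c)
  ext e
  constructor
  · intro he
    refine Finset.mem_filter.2 ⟨Finset.mem_univ _, hsimple e he, ?_⟩
    obtain ⟨y, hy, hyc⟩ :=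
      Sym2.mem_map.1 (Finset.mem_filter.1 (hF (Finset.mem_filter.1 he).2)).2.2
    rwa [Subtype.ext (a1 := y) (a2 := ⟨c, self_mem_comp F c⟩) hyc] at hy
  · intro he
    obtain ⟨-, hdiag, hc⟩ := Finset.mem_filter.1 he
    obtain ⟨⟨y, hy⟩, rfl⟩ := Sym2.mem_iff_exists.1 hc
    refine Finset.mem_filter.2 ⟨Finset.mem_univ _, ?_⟩
    rcases hnbr y (mem_comp.1 hy) with rfl | hmem
    · exact absurd rfl hdiag
    · exact hmem

lemma eq_of_subset_starEdges {σ τ : CentralityMeasure}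
    (hσl : SatLocality σ) (hσn : SatNormalisation σ) (hσb : SatBalanced σ)
    (hτl : SatLocality τ) (hτn : SatNormalisation τ) (hτb : SatBalanced τ)
    {W : Type} [Fintype W] [DecidableEq W] {c : W} {F : Finset (Sym2 W)}
    (hF : F ⊆ starEdges c) (j : W) : σ W F j = τ W F j := by
  induction F using Finset.strongInduction generalizing j with
  | H F ih =>
    have hsimple : SimpleEdges F := (simpleEdges_starEdges c).mono hF
    have hc : σ W F c = τ W F c := by
      rw [hσl W F hsimple c (self_mem_comp F c), hτl W F hsimple c (self_mem_comp F c),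
        (hσn _ _ (simpleEdges_restrictEdges hsimple _)).2.2 _ (restrictEdges_eq_starEdges hF),
        (hτn _ _ (simpleEdges_restrictEdges hsimple _)).2.2 _ (restrictEdges_eq_starEdges hF)]
    rcases F.eq_empty_or_nonempty with rfl | ⟨e, he⟩
    · rw [(hσn W ∅ hsimple).2.1 j (by simp), (hτn W ∅ hsimple).2.1 j (by simp)]
    have hdeg := degree_mul_sub_of_balanced hσb hτb hsimple
      (fun l hl => ih _ (Finset.erase_ssubset hl) ((Finset.erase_subset _ _).trans hF)) c j
    have hpos : ((F.filter fun e => c ∈ e).card : ℝ) ≠ 0 := by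
      exact_mod_cast (Finset.card_pos.2
        ⟨e, Finset.mem_filter.2 ⟨he, (Finset.mem_filter.1 (hF he)).2.2⟩⟩).ne'
    rw [hc, sub_self, mul_zero] at hdeg
    exact sub_eq_zero.1 ((mul_eq_zero.1 hdeg.symm).resolve_left hpos)

lemma SatGainLoss.sum_eq_of_subset {σ : CentralityMeasure} (hσ : SatGainLoss σ) {W : Type}
    [Fintype W] [DecidableEq W] {E F : Finset (Sym2 W)} (hF : SimpleEdges F)
    (hE : ∀ a b, Linked E a b) (hEF : E ⊆ F) : ∑ x, σ W F x = ∑ x, σ W E x := by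
  suffices ∀ K : Finset (Sym2 W), SimpleEdges (K ∪ E) → ∑ x, σ W (K ∪ E) x = ∑ x, σ W E x by
    have h := this (F \ E)
    rw [Finset.sdiff_union_of_subset hEF] at h
    exact h hF
  intro K
  induction K using Finset.induction_on with
  | empty => intro _; rw [Finset.empty_union]
  | insert e K _ ih =>
    intro hK
    rw [Finset.insert_union] at hK ⊢
    have hK' := hK.mono (Finset.subset_insert _ _)
    by_cases he : e ∈ K ∪ E
    · rw [Finset.insert_eq_of_mem he, ih hK']
    · rw [← ih hK']
      have hdiag := hK e (Finset.mem_insert_self _ _)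
      induction e with
      | h a b =>
        exact hσ W _ hK' (fun x y => (hE x y).mono Finset.subset_union_right) a b
          (by simpa using hdiag) he

lemma sum_eq_of_connected {σ τ : CentralityMeasure}
    (hσl : SatLocality σ) (hσn : SatNormalisation σ) (hσg : SatGainLoss σ) (hσb : SatBalanced σ)
    (hτl : SatLocality τ) (hτn : SatNormalisation τ) (hτg : SatGainLoss τ) (hτb : SatBalanced τ)
    {W : Type} [Fintype W] [DecidableEq W] {E : Finset (Sym2 W)} (hE : SimpleEdges E)
    (hconn : ∀ a b, Linked E a b) : ∑ x, σ W E x = ∑ x, τ W E x := by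
  rcases isEmpty_or_nonempty W with hW | ⟨⟨c⟩⟩
  · simp
  have hsimple : SimpleEdges (starEdges c ∪ E) := by
    intro e he
    rcases Finset.mem_union.1 he with he | he
    · exact simpleEdges_starEdges c e he
    · exact hE e he
  rw [← hσg.sum_eq_of_subset hsimple hconn Finset.subset_union_right,
    ← hτg.sum_eq_of_subset hsimple hconn Finset.subset_union_right,
    hσg.sum_eq_of_subset hsimple (linked_starEdges c) Finset.subset_union_left,
    hτg.sum_eq_of_subset hsimple (linked_starEdges c) Finset.subset_union_left]
  exact Finset.sum_congr rfl fun x _ =>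
    eq_of_subset_starEdges hσl hσn hσb hτl hτn hτb subset_rfl x

lemma SatLocality.sum_comp {σ : CentralityMeasure} (hσ : SatLocality σ) {W : Type} [Fintype W]
    [DecidableEq W] {E : Finset (Sym2 W)} (hE : SimpleEdges E) (i : W) :
    ∑ j ∈ comp E i, σ W E j =
      ∑ x, σ {x : W // x ∈ comp E i} (restrictEdges E (comp E i)) x := by
  have hloc : ∀ (C : Finset W) (j : W) (hj : j ∈ C), comp E j = C →
      σ W E j = σ {x : W // x ∈ C} (restrictEdges E C) ⟨j, hj⟩ := by
    rintro C j hj rfl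
    exact hσ W E hE j hj
  rw [← Finset.sum_coe_sort]
  refine Finset.sum_congr rfl fun x _ => ?_
  exact hloc _ x x.2 (comp_eq_comp_iff.2 (mem_comp.1 x.2).symm)

/-- Locality, normalisation, gain-loss and balanced link contributions determine a centrality
measure. -/
lemma eq_of_axioms {σ τ : CentralityMeasure}
    (hσl : SatLocality σ) (hσn : SatNormalisation σ) (hσg : SatGainLoss σ) (hσb : SatBalanced σ)
    (hτl : SatLocality τ) (hτn : SatNormalisation τ) (hτg : SatGainLoss τ) (hτb : SatBalanced τ)
    {W : Type} [Fintype W] [DecidableEq W] {E : Finset (Sym2 W)} (hE : SimpleEdges E) (i : W) :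
    σ W E i = τ W E i := by
  induction E using Finset.strongInduction generalizing i with
  | H E ih =>
    by_cases hi : ∀ e ∈ E, i ∉ e
    · rw [(hσn W E hE).2.1 i hi, (hτn W E hE).2.1 i hi]
    push Not at hi
    obtain ⟨e, he, hie⟩ := hi
    have hdeg := degree_mul_sub_of_balanced hσb hτb hE
      (fun l hl => ih _ (Finset.erase_ssubset hl) (hE.mono (Finset.erase_subset _ _))) i
    have hsum : ∑ j ∈ comp E i, (σ W E j - τ W E j) = 0 := by
      rw [Finset.sum_sub_distrib, hσl.sum_comp hE, hτl.sum_comp hE, sub_eq_zero]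
      exact sum_eq_of_connected hσl hσn hσg hσb hτl hτn hτg hτb
        (simpleEdges_restrictEdges hE _) linked_restrictEdges_comp
    have hzero : (∑ j ∈ comp E i, ((E.filter fun e => j ∈ e).card : ℝ)) *
        (σ W E i - τ W E i) = 0 := by
      rw [Finset.sum_mul, Finset.sum_congr rfl fun j _ => hdeg j, ← Finset.mul_sum, hsum,
        mul_zero]
    have hpos : (0 : ℝ) < ∑ j ∈ comp E i, ((E.filter fun e => j ∈ e).card : ℝ) := by
      refine Finset.sum_pos' (fun j _ => Nat.cast_nonneg _) ⟨i, self_mem_comp E i, ?_⟩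
      exact_mod_cast Finset.card_pos.2 ⟨e, Finset.mem_filter.2 ⟨he, hie⟩⟩
    exact sub_eq_zero.1 ((mul_eq_zero.1 hzero).resolve_left hpos.ne')

lemma satAxioms_of_eq_positionValue {τ : CentralityMeasure}
    (h : ∀ (W : Type) [Fintype W] [DecidableEq W], ∀ (E : Finset (Sym2 W)), SimpleEdges E →
      ∀ i : W, τ W E i = positionValue va E i) :
    SatLocality τ ∧ SatNormalisation τ ∧ SatGainLoss τ ∧ SatBalanced τ := by
  refine ⟨?_, ?_, ?_, ?_⟩
  · intro W _ _ E hE i hi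
    rw [h W E hE, h _ _ (simpleEdges_restrictEdges hE _)]
    exact positionValue_va_restrictEdges i hi
  · intro W _ _ E hE
    refine ⟨fun i => ?_, fun i hi => ?_, fun c hc => ?_⟩
    · rw [h W E hE]
      exact ⟨positionValue_va_nonneg E i, positionValue_va_le E i⟩
    · rw [h W E hE, positionValue_va_of_isolated hi]
    · rw [h W E hE, hc, positionValue_va_starEdges]
  · intro W _ _ E hE hconn i j hij _
    have hE' : SimpleEdges (insert s(i, j) E) := by
      intro e he
      rcases Finset.mem_insert.1 he with rfl | he
      · simpa using hij
      · exact hE e he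
    simp only [h W _ hE, h W _ hE']
    rw [sum_positionValue_va hE, sum_positionValue_va hE',
      linkGame_va_insert_of_linked (hconn i j)]
  · intro W _ _ E hE i j
    have herase : ∀ l, SimpleEdges (E.erase l) := fun l => hE.mono (Finset.erase_subset _ _)
    simp only [h W _ hE, h W _ (herase _)]
    exact positionValue_va_balanced E i j

/-- the position attachment centrality is the unique centrality measure
satisfying Locality, Normalisation, Gain-Loss and Balanced link contributions. -/
theorem PA_characterisation (σ : CentralityMeasure) :
    (SatLocality σ ∧ SatNormalisation σ ∧ SatGainLoss σ ∧ SatBalanced σ) ↔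
      ∀ (W : Type) [Fintype W] [DecidableEq W],
        ∀ (E : Finset (Sym2 W)), SimpleEdges E →
          ∀ i : W, σ W E i = positionValue va E i := by
  refine ⟨?_, satAxioms_of_eq_positionValue⟩
  rintro ⟨hl, hn, hg, hb⟩ W _ _ E hE i
  obtain ⟨hl', hn', hg', hb'⟩ := satAxioms_of_eq_positionValue
    (τ := fun W _ _ E i => positionValue va E i) fun _ _ _ _ _ _ => rfl
  exact eq_of_axioms hl hn hg hb hl' hn' hg' hb' hE i

end
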